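/- arXiv:2605.14351 — 2 statements merged into one kernel-verified Lean document; each statement's English description precedes it below -/
import Mathlib

section
/- Let μ be a finite positive Borel measure on ℂ whose support is contained in the closed disk {p : |p| ≤ ρ} with ρ < 1, and suppose the support of μ has a cluster (accumulation) point lying in the open disk {p : |p| < ρ}. Then for any pairwise distinct time indices t₁,…,tₙ ∈ ℕ and coefficients a₁,…,aₙ ∈ ℂ, if ∑_{i,j} a_i · conj(a_j) · K_μ(t_i,t_j) = 0, then a_i = 0 for all i. That is, K_μ is strictly positive definite on every finite set of distinct indices. -/
open MeasureTheory Metric Filter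

/-- The topological support of a Borel measure on `ℂ`. -/
def measSupport (μ : Measure ℂ) : Set ℂ := {x | ∀ U ∈ nhds x, μ U ≠ 0}

/-- The disk moment kernel `K_μ(s,t) = ∫ p^s · conj(p)^t dμ(p)`. -/
noncomputable def diskKernel (μ : Measure ℂ) (s t : ℕ) : ℂ :=
  ∫ p, p ^ s * (starRingEnd ℂ p) ^ t ∂μ

lemma measSupport_eq_support (μ : Measure ℂ) : measSupport μ = μ.support := by
  ext x
  simp [measSupport, Measure.mem_support_iff_forall, pos_iff_ne_zero]

/-- A continuous function vanishing almost everywhere vanishes on the support. -/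
lemma eq_zero_of_mem_measSupport {μ : Measure ℂ} {f : ℂ → ℂ} (hf : Continuous f)
    (h : ∀ᵐ p ∂μ, f p = 0) {x : ℂ} (hx : x ∈ measSupport μ) : f x = 0 := by
  by_contra hne
  exact hx {p | f p ≠ 0} ((isOpen_ne_fun hf continuous_const).mem_nhds hne) (ae_iff.mp h)

/-- Continuous functions are integrable against a finite measure with bounded support. -/
lemma integrable_of_measSupport_subset_closedBall {μ : Measure ℂ} [IsFiniteMeasure μ] {ρ : ℝ}
    (hsupp : measSupport μ ⊆ closedBall (0 : ℂ) ρ) {f : ℂ → ℂ} (hf : Continuous f) :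
    Integrable f μ := by
  obtain ⟨C, hC⟩ := (isCompact_closedBall (0 : ℂ) ρ).exists_bound_of_continuousOn hf.continuousOn
  refine Integrable.of_bound hf.aestronglyMeasurable C ?_
  filter_upwards [Measure.support_mem_ae (μ := μ)] with p hp
  exact hC p (hsupp (measSupport_eq_support μ ▸ hp))

/-- The quadratic form of the disk moment kernel is the squared `L²` norm of the associated
polynomial. -/
lemma sum_diskKernel_eq_integral_normSq {μ : Measure ℂ} [IsFiniteMeasure μ] {ρ : ℝ}
    (hsupp : measSupport μ ⊆ closedBall (0 : ℂ) ρ) {n : ℕ} (t : Fin n → ℕ) (a : Fin n → ℂ) :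
    ∑ i, ∑ j, a i * (starRingEnd ℂ) (a j) * diskKernel μ (t i) (t j) =
      ((∫ p, Complex.normSq (∑ i, a i * p ^ t i) ∂μ : ℝ) : ℂ) := by
  have hint (i j : Fin n) : Integrable
      (fun p : ℂ ↦ a i * (starRingEnd ℂ) (a j) * (p ^ t i * (starRingEnd ℂ p) ^ t j)) μ :=
    integrable_of_measSupport_subset_closedBall hsupp (by fun_prop)
  rw [← integral_complex_ofReal]
  simp_rw [diskKernel, ← integral_const_mul]
  simp_rw [← integral_finsetSum _ fun j _ ↦ hint _ j]
  rw [← integral_finsetSum _ fun i _ ↦ integrable_finsetSum _ fun j _ ↦ hint i j]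
  congr 1 with p
  rw [← Complex.mul_conj, map_sum, Finset.sum_mul_sum]
  refine Finset.sum_congr rfl fun i _ ↦ Finset.sum_congr rfl fun j _ ↦ ?_
  rw [map_mul, map_pow]
  ring

/-- If `μ` is a finite positive Borel measure supported in the closed disk of radius
`ρ < 1` whose support has an accumulation point in the open disk of radius `ρ`, then the
disk moment kernel `K_μ` is strictly positive definite on every finite set of distinct
time indices: vanishing of the quadratic form forces all coefficients to vanish. -/
theorem stmt_1 (μ : Measure ℂ) [IsFiniteMeasure μ] (ρ : ℝ) (hρ : ρ < 1)
    (hsupp : measSupport μ ⊆ closedBall (0 : ℂ) ρ)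
    (hacc : ∃ z : ℂ, ‖z‖ < ρ ∧ AccPt z (Filter.principal (measSupport μ)))
    (n : ℕ) (t : Fin n → ℕ) (ht : Function.Injective t) (a : Fin n → ℂ)
    (hzero : (∑ i, ∑ j, a i * (starRingEnd ℂ) (a j) * diskKernel μ (t i) (t j)) = 0) :
    ∀ i, a i = 0 := by
  have hcont : Continuous fun p : ℂ ↦ ∑ i, a i * p ^ t i := by fun_prop
  have hint : Integrable (fun p : ℂ ↦ Complex.normSq (∑ i, a i * p ^ t i)) μ := by
    have := (integrable_of_measSupport_subset_closedBall hsupp (f := fun p ↦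
      (Complex.normSq (∑ i, a i * p ^ t i) : ℂ))
      (Complex.continuous_ofReal.comp (Complex.continuous_normSq.comp hcont))).re
    simpa using this
  rw [sum_diskKernel_eq_integral_normSq hsupp, Complex.ofReal_eq_zero,
    integral_eq_zero_iff_of_nonneg (fun p ↦ Complex.normSq_nonneg _) hint] at hzero
  have hae : ∀ᵐ p ∂μ, ∑ i, a i * p ^ t i = 0 :=
    hzero.mono fun p hp ↦ Complex.normSq_eq_zero.mp hp
  obtain ⟨z, -, hz⟩ := hacc
  have hinf : (measSupport μ).Infinite := .of_accPt hz
  let P : Polynomial ℂ := ∑ i, Polynomial.monomial (t i) (a i)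
  have hP : P = 0 := Polynomial.eq_zero_of_infinite_isRoot P <| hinf.mono fun x hx ↦ by
    simpa [P, Polynomial.IsRoot, Polynomial.eval_finsetSum] using
      eq_zero_of_mem_measSupport hcont hae hx
  intro i
  simpa [P, Polynomial.finsetSum_coeff, Polynomial.coeff_monomial, ht.eq_iff] using
    congrArg (fun Q ↦ Q.coeff (t i)) hP
end

section
/- Define K : ℕ × ℕ → ℂ by K(s,t) = 1 if s = t and s ≤ 1, and K(s,t) = 0 otherwise. Then: (i) K is Hermitian positive semidefinite; (ii) the unit-radius defect kernel (s,t) ↦ K(s,t) − K(s+1,t+1) is Hermitian positive semidefinite; (iii) there exists NO finite positive Borel measure μ on ℂ supported in the closed unit disk such that K(s,t) = ∫ p^s · conj(p)^t dμ(p) for all s,t ∈ ℕ. In particular, positive semidefiniteness together with the unit-radius shift-defect condition does not characterize disk moment kernels. -/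
open MeasureTheory Metric
open scoped ComplexOrder

/-- The counterexample kernel: `K(s,t) = 1` if `s = t ≤ 1`, and `0` otherwise. -/
def exKernel (s t : ℕ) : ℂ := if s = t ∧ s ≤ 1 then 1 else 0

theorem measure_compl_eq_zero_of_measSupport_subset {μ : Measure ℂ} {s : Set ℂ}
    (h : measSupport μ ⊆ s) : μ sᶜ = 0 := by
  refine measure_null_of_locally_null _ fun x hx => ?_
  have hx' : x ∉ measSupport μ := fun hm => hx (h hm)
  simp only [measSupport, Set.mem_ofPred_eq, not_forall, not_not] at hx'
  obtain ⟨U, hU, hU0⟩ := hx'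
  exact ⟨U, mem_nhdsWithin_of_mem_nhds hU, hU0⟩

theorem sum_mul_conj_mul_rankOne_nonneg {ι : Type*} [Fintype ι] (a f : ι → ℂ) :
    0 ≤ ∑ i, ∑ j, a i * (starRingEnd ℂ) (a j) * (f i * (starRingEnd ℂ) (f j)) := by
  have h : ∑ i, ∑ j, a i * (starRingEnd ℂ) (a j) * (f i * (starRingEnd ℂ) (f j)) =
      (∑ i, a i * f i) * star (∑ i, a i * f i) := by
    rw [← starRingEnd_apply, map_sum, Finset.sum_mul_sum]
    refine Finset.sum_congr rfl fun i _ => Finset.sum_congr rfl fun j _ => ?_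
    rw [map_mul]
    ring
  rw [h]
  exact mul_star_self_nonneg _

theorem exKernel_eq_add (s t : ℕ) :
    exKernel s t =
      (if s = 0 then 1 else 0) * (starRingEnd ℂ) (if t = 0 then 1 else 0) +
      (if s = 1 then 1 else 0) * (starRingEnd ℂ) (if t = 1 then 1 else 0) := by
  unfold exKernel
  split_ifs <;> first | omega | simp

theorem exKernel_sub_shift (s t : ℕ) :
    exKernel s t - exKernel (s + 1) (t + 1) =
      (if s = 1 then 1 else 0) * (starRingEnd ℂ) (if t = 1 then 1 else 0) := by
  unfold exKernel
  split_ifs <;> first | omega | simp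

/-- A finite measure on the closed unit disk whose fourth absolute moment vanishes is
concentrated at the origin. -/
theorem ae_eq_zero_of_integral_sq_mul_conj_sq_eq_zero {μ : Measure ℂ} [IsFiniteMeasure μ]
    (hs : measSupport μ ⊆ closedBall (0 : ℂ) 1)
    (h : ∫ p, p ^ 2 * (starRingEnd ℂ p) ^ 2 ∂μ = 0) : ∀ᵐ p ∂μ, p = 0 := by
  have hball : ∀ᵐ p ∂μ, p ∈ closedBall (0 : ℂ) 1 :=
    measure_compl_eq_zero_of_measSupport_subset hs
  have hint : Integrable (fun p : ℂ => ‖p‖ ^ 4) μ := by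
    refine Integrable.of_bound (by fun_prop) 1 ?_
    filter_upwards [hball] with p hp
    rw [mem_closedBall_zero_iff] at hp
    simpa using pow_le_one₀ (norm_nonneg p) hp
  have hreal : ∫ p, ‖p‖ ^ 4 ∂μ = 0 := by
    have hpt : ∀ p : ℂ, p ^ 2 * (starRingEnd ℂ p) ^ 2 = ((‖p‖ ^ 4 : ℝ) : ℂ) := fun p => by
      rw [← mul_pow, Complex.mul_conj']
      push_cast
      ring
    simp_rw [hpt] at h
    rw [integral_complex_ofReal] at h
    exact_mod_cast h
  rw [integral_eq_zero_iff_of_nonneg (fun p => by positivity) hint] at hreal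
  filter_upwards [hreal] with p hp
  simpa using hp

/-- The kernel `exKernel` is Hermitian positive semidefinite, its unit-radius defect
kernel `(s,t) ↦ K(s,t) − K(s+1,t+1)` is also Hermitian positive semidefinite, yet no
finite positive Borel measure supported in the closed unit disk represents it as a disk
moment kernel.  Hence PSD plus the unit-radius shift-defect condition does not
characterize disk moment kernels. -/
theorem stmt_9 :
    (∀ (n : ℕ) (t : Fin n → ℕ) (a : Fin n → ℂ),
        0 ≤ ∑ i, ∑ j, a i * (starRingEnd ℂ) (a j) * exKernel (t i) (t j)) ∧
    (∀ (n : ℕ) (t : Fin n → ℕ) (a : Fin n → ℂ),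
        0 ≤ ∑ i, ∑ j, a i * (starRingEnd ℂ) (a j) *
              (exKernel (t i) (t j) - exKernel (t i + 1) (t j + 1))) ∧
    ¬ ∃ μ : Measure ℂ, IsFiniteMeasure μ ∧
        measSupport μ ⊆ closedBall (0 : ℂ) 1 ∧
        ∀ s t : ℕ, exKernel s t = ∫ p, p ^ s * (starRingEnd ℂ p) ^ t ∂μ := by
  refine ⟨fun n t a => ?_, fun n t a => ?_, ?_⟩
  · simp_rw [exKernel_eq_add, mul_add, Finset.sum_add_distrib]
    exact add_nonneg (sum_mul_conj_mul_rankOne_nonneg a fun i => if t i = 0 then 1 else 0)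
      (sum_mul_conj_mul_rankOne_nonneg a fun i => if t i = 1 then 1 else 0)
  · simp_rw [exKernel_sub_shift]
    exact sum_mul_conj_mul_rankOne_nonneg a fun i => if t i = 1 then 1 else 0
  · rintro ⟨μ, _, hs, hK⟩
    have h_zero : ∀ᵐ p ∂μ, p = 0 :=
      ae_eq_zero_of_integral_sq_mul_conj_sq_eq_zero hs (by rw [← hK]; simp [exKernel])
    have h_one : ∫ p, p ^ 1 * (starRingEnd ℂ p) ^ 1 ∂μ = 1 := by
      rw [← hK 1 1]; simp [exKernel]
    rw [integral_eq_zero_of_ae (h_zero.mono fun p hp => by simp [hp])] at h_one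
    exact zero_ne_one h_one
end
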